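/- arXiv:1104.3677 — 4 statements merged into one kernel-verified Lean document; each statement's English description precedes it below -/
import Mathlib

section
/- Let k be a nonnegative integer and let G be a connected graph containing no bridge uv such that each of the two connected components of G − uv has at least k+2 vertices. If {W_1, …, W_ℓ} is a P_ℓ-witness structure of G with |V(G)| − ℓ ≤ k, then ℓ ≤ 4k+3. -/
open SimpleGraph

/-- An `H`-witness structure of `G`, encoded by the map sending each vertex of `G` to the
vertex of `H` whose witness set contains it. -/
def IsWitnessStructure {V W : Type} (G : SimpleGraph V) (H : SimpleGraph W) (f : V → W) :
    Prop :=
  Function.Surjective f ∧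
  (∀ h : W, (G.induce (f ⁻¹' {h})).Connected) ∧
  ∀ h₁ h₂ : W, h₁ ≠ h₂ → (H.Adj h₁ h₂ ↔ ∃ u v : V, f u = h₁ ∧ f v = h₂ ∧ G.Adj u v)

/-- In a connected graph, deleting the edge `uv` leaves every vertex reachable from `u` or `v`. -/
theorem SimpleGraph.Connected.reachable_deleteEdges_or {V : Type} {G : SimpleGraph V}
    (hG : G.Connected) (u v x : V) :
    (G.deleteEdges {s(u, v)}).Reachable u x ∨ (G.deleteEdges {s(u, v)}).Reachable v x := by
  obtain ⟨p⟩ := hG.preconnected x u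
  induction p with
  | nil => exact Or.inl (Reachable.refl _)
  | @cons x y u h p ih =>
    by_cases he : s(x, y) = s(u, v)
    · rcases Sym2.eq_iff.1 he with ⟨rfl, -⟩ | ⟨rfl, -⟩
      · exact Or.inl (Reachable.refl _)
      · exact Or.inr (Reachable.refl _)
    · have hxy : (G.deleteEdges {s(u, v)}).Adj y x :=
        (deleteEdges_adj.2 ⟨h, by simpa using he⟩).symm
      exact ih.imp (·.trans hxy.reachable) (·.trans hxy.reachable)

/-- A set of vertices closed under adjacency is closed under reachability. -/
theorem SimpleGraph.Reachable.mem_of_adj_closed {V : Type} {G : SimpleGraph V} {S : Set V}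
    (hS : ∀ x y, G.Adj x y → x ∈ S → y ∈ S) {x y : V} (h : G.Reachable x y) (hx : x ∈ S) :
    y ∈ S := by
  obtain ⟨p⟩ := h
  induction p with
  | nil => exact hx
  | cons h p ih => exact ih (hS _ _ h hx)

/-- In a path witness structure, adjacent vertices have witness indices differing by at most
one. -/
theorem IsWitnessStructure.index_close {V : Type} {G : SimpleGraph V} {ℓ : ℕ} {f : V → Fin ℓ}
    (hf : IsWitnessStructure G (pathGraph ℓ) f) {x y : V} (h : G.Adj x y) :
    (f x : ℕ) ≤ f y + 1 := by
  by_cases hxy : f x = f y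
  · rw [hxy]; omega
  · have := (hf.2.2 _ _ hxy).2 ⟨x, y, rfl, rfl, h⟩
    rw [pathGraph_adj] at this
    omega

/-- Two consecutive small witness sets `{u}`, `{v}` of a path witness structure are joined by a
bridge, whose removal separates the smaller witness indices from the larger ones. -/
theorem IsWitnessStructure.isBridge_of_small {V : Type} {G : SimpleGraph V} (hG : G.Connected)
    {ℓ : ℕ} {f : V → Fin ℓ} (hf : IsWitnessStructure G (pathGraph ℓ) f) {u v : V}
    (huv : (f u : ℕ) + 1 = f v) (hu : ∀ x, f x = f u → x = u) (hv : ∀ x, f x = f v → x = v) :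
    G.IsBridge s(u, v) ∧
      (∀ x, f x ≤ f u → (G.deleteEdges {s(u, v)}).Reachable u x) ∧
      ∀ x, f v ≤ f x → (G.deleteEdges {s(u, v)}).Reachable v x := by
  have hne : f u ≠ f v := fun h => by rw [h] at huv; omega
  have hadj : G.Adj u v := by
    obtain ⟨x, y, hx, hy, h⟩ := (hf.2.2 _ _ hne).1 (pathGraph_adj.2 (Or.inl huv))
    rwa [hu x hx, hv y hy] at h
  have cross : ∀ x y, (G.deleteEdges {s(u, v)}).Adj x y → f x ≤ f u → f y ≤ f u := by
    intro x y h hx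
    rw [deleteEdges_adj] at h
    by_contra hy
    have := hf.index_close h.1.symm
    have hxu : x = u := hu x (Fin.ext (by omega))
    have hyv : y = v := hv y (Fin.ext (by omega))
    exact h.2 (by simp [hxu, hyv])
  have left : ∀ x, (G.deleteEdges {s(u, v)}).Reachable u x → f x ≤ f u := fun x h =>
    h.mem_of_adj_closed (S := {x | f x ≤ f u}) cross (le_refl (f u))
  have right : ∀ x, (G.deleteEdges {s(u, v)}).Reachable v x → ¬ f x ≤ f u := fun x h =>
    h.mem_of_adj_closed (S := {x | ¬ f x ≤ f u}) (fun x y h hx hy => hx (cross y x h.symm hy))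
      (show ¬ f v ≤ f u by omega)
  refine ⟨?_, fun x hx => ?_, fun x hx => ?_⟩
  · rw [isBridge_iff]
    exact fun h => right v (Reachable.refl _) (left v h)
  · exact (hG.reachable_deleteEdges_or u v x).resolve_right fun h => right x h hx
  · exact (hG.reachable_deleteEdges_or u v x).resolve_left fun h => by
      have := left x h
      omega

theorem stmt3 {V : Type} [Finite V] (G : SimpleGraph V) (hG : G.Connected) (k : ℕ)
    (hnb : ∀ u v : V, G.IsBridge s(u, v) →
      ¬(k + 2 ≤ {x : V | (G.deleteEdges {s(u, v)}).Reachable u x}.ncard ∧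
        k + 2 ≤ {x : V | (G.deleteEdges {s(u, v)}).Reachable v x}.ncard))
    (ℓ : ℕ) (f : V → Fin ℓ) (hf : IsWitnessStructure G (SimpleGraph.pathGraph ℓ) f)
    (hk : Nat.card V - ℓ ≤ k) :
    ℓ ≤ 4 * k + 3 := by
  by_contra! hℓ
  obtain ⟨s, hs⟩ := hf.1.hasRightInverse
  have card_le : ∀ (S : Set V) (T : Finset (Fin ℓ)), (∀ i ∈ T, s i ∈ S) → T.card ≤ S.ncard := by
    intro S T h
    rw [← Set.ncard_coe_finset, ← Set.ncard_image_of_injective _ hs.injective]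
    exact Set.ncard_le_ncard (by rintro _ ⟨i, hi, rfl⟩; exact h i hi) S.toFinite
  have extra : ∀ j : Fin (k + 1), ∃ x, x ≠ s (f x) ∧
      ((f x : ℕ) = k + 1 + 2 * j ∨ (f x : ℕ) = k + 2 + 2 * j) := by
    intro j
    by_contra! hsmall
    let a : Fin ℓ := ⟨k + 1 + 2 * j, by omega⟩
    let b : Fin ℓ := ⟨k + 2 + 2 * j, by omega⟩
    have small : ∀ i, i = a ∨ i = b → ∀ x, f x = f (s i) → x = s i := by
      intro i hi x hx
      rw [hs] at hx
      by_contra hne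
      have := hsmall x (by rwa [hx])
      rcases hi with rfl | rfl
      · exact this.1 (by simp [hx, a])
      · exact this.2 (by simp [hx, b])
    obtain ⟨hbr, hl, hr⟩ := hf.isBridge_of_small hG (u := s a) (v := s b)
      (by rw [hs, hs]; simp only [a, b]; omega) (small a (Or.inl rfl)) (small b (Or.inr rfl))
    rw [hs] at hl hr
    refine hnb _ _ hbr ⟨?_, ?_⟩
    · refine le_trans ?_ (card_le _ (Finset.Iic a) fun i hi => hl _ ?_)
      · simp only [Fin.card_Iic, a]; omega
      · rw [hs]; exact Finset.mem_Iic.1 hi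
    · refine le_trans ?_ (card_le _ (Finset.Ici b) fun i hi => hr _ ?_)
      · simp only [Fin.card_Ici, b]; omega
      · rw [hs]; exact Finset.mem_Ici.1 hi
  choose e he he' using extra
  have inj : Function.Injective (Sum.elim s e) := by
    refine hs.injective.sumElim (fun i j hij => ?_) fun i j hij => ?_
    · have hi := he' i
      have hj := he' j
      rw [hij] at hi
      omega
    · exact he j (by rw [← hij, hs])
  have := Nat.card_le_card_of_injective _ inj
  simp only [Nat.card_sum, Nat.card_fin] at this
  omega
end

section
/- Let k be a nonnegative integer and let G be a connected graph containing no bridge uv such that each of the two connected components of G − uv has at least k+2 vertices. If G is k-contractible to a path, then |V(G)| ≤ 5k+3. -/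
open SimpleGraph

/-- `G` is `k`-contractible to `H`. -/
def KContractible {V W : Type} (G : SimpleGraph V) (H : SimpleGraph W) (k : ℕ) : Prop :=
  (∃ f : V → W, IsWitnessStructure G H f) ∧ Nat.card V - Nat.card W ≤ k

/-- `G` is `k`-contractible to a path. -/
def KContractibleToPath {V : Type} (G : SimpleGraph V) (k : ℕ) : Prop :=
  ∃ ℓ : ℕ, KContractible G (SimpleGraph.pathGraph ℓ) k

/-- After deleting an edge `uv` of a connected graph, every vertex is reachable from `u` or `v`. -/
theorem SimpleGraph.Connected.reachable_or_reachable_deleteEdges {V : Type*} {G : SimpleGraph V}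
    (hG : G.Connected) (u v x : V) :
    (G.deleteEdges {s(u, v)}).Reachable u x ∨ (G.deleteEdges {s(u, v)}).Reachable v x := by
  have h := (G.reachable_iff_reflTransGen u x).1 (hG.preconnected u x)
  induction h with
  | refl => exact .inl .rfl
  | @tail b c _ hbc ih =>
    by_cases he : s(b, c) = s(u, v)
    · rcases Sym2.eq_iff.1 he with ⟨-, rfl⟩ | ⟨-, rfl⟩
      · exact .inr .rfl
      · exact .inl .rfl
    · have hadj : (G.deleteEdges {s(u, v)}).Adj b c := by
        rw [deleteEdges_adj]
        exact ⟨hbc, he⟩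
      exact ih.imp (fun h => h.trans hadj.reachable) (fun h => h.trans hadj.reachable)

/-- A predicate preserved along edges is preserved along reachability. -/
theorem SimpleGraph.Reachable.iff_of_adj {V : Type*} {G : SimpleGraph V} {p : V → Prop}
    (hp : ∀ x y, G.Adj x y → (p x ↔ p y)) {x y : V} (h : G.Reachable x y) : p x ↔ p y := by
  rw [reachable_iff_reflTransGen] at h
  induction h with
  | refl => rfl
  | tail _ hbc ih => exact ih.trans (hp _ _ hbc)

/-- A set containing the image of `Fin m` under an injective map has at least `m` elements. -/
theorem Set.le_ncard_of_injective_fin {V : Type*} [Finite V] {m : ℕ} {S : Set V} (g : Fin m → V)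
    (hg : Function.Injective g) (hS : ∀ i, g i ∈ S) : m ≤ S.ncard := by
  have h := Set.ncard_le_ncard (Set.range_subset_iff.2 hS) S.toFinite
  rwa [Set.ncard_range_of_injective hg, Nat.card_eq_fintype_card, Fintype.card_fin] at h

theorem stmt4 {V : Type} [Finite V] (G : SimpleGraph V) (hG : G.Connected) (k : ℕ)
    (hnb : ∀ u v : V, G.IsBridge s(u, v) →
      ¬(k + 2 ≤ {x : V | (G.deleteEdges {s(u, v)}).Reachable u x}.ncard ∧
        k + 2 ≤ {x : V | (G.deleteEdges {s(u, v)}).Reachable v x}.ncard))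
    (h : KContractibleToPath G k) :
    Nat.card V ≤ 5 * k + 3 := by
  obtain ⟨ℓ, ⟨f, hsurj, -, hadj⟩, hcard⟩ := h
  rw [Nat.card_eq_fintype_card (α := Fin ℓ), Fintype.card_fin] at hcard
  by_contra! hn
  obtain ⟨s, hs⟩ := hsurj.hasRightInverse
  have hsinj : Function.Injective s := hs.injective
  obtain ⟨j, hj⟩ : ∃ j : Fin (k + 1), ∀ v : V,
      ((f v : ℕ) = k + 1 + 2 * j ∨ (f v : ℕ) = k + 2 + 2 * j) → v = s (f v) := by
    by_contra! hbig
    choose t ht hts using hbig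
    have hinj : Function.Injective (Sum.elim s t) := by
      refine hsinj.sumElim (fun i j hij => ?_) fun a b hab => ?_
      · have hi := ht i
        have hj := ht j
        rw [hij] at hi
        ext
        omega
      · apply hts b
        rw [← hab, hs a]
    have hle := Nat.card_le_card_of_injective _ hinj
    simp only [Nat.card_eq_fintype_card (α := Fin ℓ ⊕ Fin (k + 1)), Fintype.card_sum,
      Fintype.card_fin] at hle
    omega
  have hjk := j.isLt
  obtain ⟨u, v, hu, hv, huv⟩ := (hadj ⟨k + 1 + 2 * j, by omega⟩ ⟨k + 2 + 2 * j, by omega⟩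
    (by simp only [ne_eq, Fin.mk.injEq]; omega)).1
    (by rw [pathGraph_adj]; left; simp only; omega)
  have huval : (f u : ℕ) = k + 1 + 2 * j := by rw [hu]
  have hvval : (f v : ℕ) = k + 2 + 2 * j := by rw [hv]
  have hcross : ∀ x y, G.Adj x y → (f x : ℕ) ≤ k + 1 + 2 * j → k + 1 + 2 * j < (f y : ℕ) →
      x = u ∧ y = v := by
    intro x y hxy hx hy
    have hp := (hadj (f x) (f y) (by intro h; rw [h] at hx; omega)).2 ⟨x, y, rfl, rfl, hxy⟩
    rw [pathGraph_adj] at hp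
    have hfx : f x = f u := by ext; omega
    have hfy : f y = f v := by ext; omega
    constructor
    · rw [hj x (by omega), hj u (by omega), hfx]
    · rw [hj y (by omega), hj v (by omega), hfy]
  have hinv : ∀ x y, (G.deleteEdges {s(u, v)}).Adj x y →
      ((f x : ℕ) ≤ k + 1 + 2 * j ↔ (f y : ℕ) ≤ k + 1 + 2 * j) := by
    intro x y hxy
    rw [deleteEdges_adj] at hxy
    obtain ⟨hxy, hne⟩ := hxy
    constructor
    · intro hx
      by_contra! hy
      obtain ⟨rfl, rfl⟩ := hcross x y hxy hx hy
      exact hne rfl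
    · intro hy
      by_contra! hx
      obtain ⟨rfl, rfl⟩ := hcross y x hxy.symm hy hx
      exact hne Sym2.eq_swap
  have hreach := hG.reachable_or_reachable_deleteEdges u v
  refine hnb u v ?_ ⟨?_, ?_⟩
  · rw [isBridge_iff]
    intro h
    have := h.iff_of_adj hinv
    omega
  · refine Set.le_ncard_of_injective_fin (fun i : Fin (k + 2) => s ⟨i, by omega⟩)
      (fun a b hab => ?_) fun i => (hreach _).resolve_right fun h => ?_
    · simpa [Fin.ext_iff] using hsinj hab
    · have := h.iff_of_adj hinv
      rw [hs] at this
      simp only at this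
      omega
  · refine Set.le_ncard_of_injective_fin
      (fun i : Fin (k + 2) => s ⟨k + 2 + 2 * j + i, by omega⟩)
      (fun a b hab => ?_) fun i => (hreach _).resolve_left fun h => ?_
    · simpa [Fin.ext_iff] using hsinj hab
    · have := h.iff_of_adj hinv
      rw [hs] at this
      simp only at this
      omega
end

section
/- Let G be a 2-connected graph, let T be a tree, and let φ be a 2-coloring of G that is compatible with a T-witness structure W of G. Then every monochromatic component of G with respect to φ is a union of witness sets W(y), y ∈ Y, for some set Y ⊆ V(T) inducing a subtree of T, and contains at most one big witness set of W; consequently, the set of monochromatic components of G with respect to φ is a T''-witness structure of G for some tree T'' with |V(T'')| ≤ |V(T)|. -/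
open SimpleGraph

/-- The witness set of `h` is big if it contains at least two vertices. -/
def BigSet {V W : Type} (f : V → W) (h : W) : Prop := 1 < (f ⁻¹' {h}).ncard

/-- A graph is 2-connected if it is connected, has at least three vertices, and has no
cut vertex. -/
def TwoConnected {V : Type} (G : SimpleGraph V) : Prop :=
  G.Connected ∧ 3 ≤ Nat.card V ∧ ∀ v : V, (G.induce ({v}ᶜ : Set V)).Connected

/-- A set is monochromatic w.r.t. a 2-coloring if the coloring is constant on it. -/
def Monochromatic {V : Type} (φ : V → Fin 2) (S : Set V) : Prop :=
  ∀ x ∈ S, ∀ y ∈ S, φ x = φ y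

/-- A monochromatic component of `G` w.r.t. `φ`: a connected component of the subgraph
induced by one of the color classes, i.e. a maximal monochromatic connected set. -/
def MonoComponent {V : Type} (G : SimpleGraph V) (φ : V → Fin 2) (X : Set V) : Prop :=
  X.Nonempty ∧ Monochromatic φ X ∧ (G.induce X).Connected ∧
  ∀ Y : Set V, X ⊆ Y → Monochromatic φ Y → (G.induce Y).Connected → Y = X

/-- A 2-coloring `φ` is compatible with the `T`-witness structure given by `f`:
every witness set is monochromatic, and big witness sets corresponding to adjacent
vertices of `T` receive different colors. -/
def TreeCompatible {V W : Type} (G : SimpleGraph V) (T : SimpleGraph W) (f : V → W)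
    (φ : V → Fin 2) : Prop :=
  (∀ x y : V, f x = f y → φ x = φ y) ∧
  ∀ u v : W, T.Adj u v → BigSet f u → BigSet f v →
    ∀ x y : V, f x = u → f y = v → φ x ≠ φ y

section Helpers

variable {V W : Type} {G : SimpleGraph V} {T : SimpleGraph W} {f : V → W} {φ : V → Fin 2}

/-- A predicate preserved along edges is preserved along reachability. -/
theorem reachable_invariant {P : V → Prop}
    (h : ∀ a b, G.Adj a b → P a → P b) {a b : V} (hab : G.Reachable a b) (ha : P a) : P b := by
  obtain ⟨p⟩ := hab
  induction p with
  | nil => exact ha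
  | cons hadj _ ih => exact ih (h _ _ hadj ha)

theorem reachable_induce_mono {A B : Set V} (h : A ⊆ B) (hA : (G.induce A).Connected)
    {x y : V} (hx : x ∈ A) (hy : y ∈ A) : (G.induce B).Reachable ⟨x, h hx⟩ ⟨y, h hy⟩ :=
  (hA.preconnected ⟨x, hx⟩ ⟨y, hy⟩).map (induceHomOfLE G h).toHom

theorem connected_of_common_reachable {v : V} (h : ∀ x, G.Reachable x v) : G.Connected :=
  have : Nonempty V := ⟨v⟩
  ⟨fun x y => (h x).trans (h y).symm⟩

/-- A map sending edges to edges or single vertices preserves reachability. -/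
theorem reachable_weakHom (h : ∀ a b, G.Adj a b → f a ≠ f b → T.Adj (f a) (f b)) {a b : V}
    (hab : G.Reachable a b) : T.Reachable (f a) (f b) := by
  refine reachable_invariant (P := fun x => T.Reachable (f a) (f x)) ?_ hab (Reachable.refl _)
  intro x y hxy hx
  by_cases he : f x = f y
  · rwa [← he]
  · exact hx.trans (h x y hxy he).reachable

theorem IsWitnessStructure.adj_of_adj (hf : IsWitnessStructure G T f) {x y : V}
    (h : G.Adj x y) (hne : f x ≠ f y) : T.Adj (f x) (f y) :=
  (hf.2.2 _ _ hne).2 ⟨x, y, rfl, rfl, h⟩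

theorem eq_of_not_bigSet [Finite V] {t : W} (h : ¬ BigSet f t) {x y : V} (hx : f x = t)
    (hy : f y = t) : x = y :=
  (Set.ncard_le_one_iff (s := f ⁻¹' {t})).1 (not_lt.1 h) hx hy

/-- Preimages of connected sets under a witness structure are connected. -/
theorem IsWitnessStructure.connected_preimage (hf : IsWitnessStructure G T f) {Y : Set W}
    (hY : (T.induce Y).Connected) : (G.induce (f ⁻¹' Y)).Connected := by
  obtain ⟨t₀, ht₀⟩ := hY.nonempty
  obtain ⟨x₀, rfl⟩ := hf.1 t₀
  refine connected_of_common_reachable (v := ⟨x₀, ht₀⟩) ?_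
  have hfib : ∀ t ∈ Y, f ⁻¹' {t} ⊆ f ⁻¹' Y := by
    rintro t ht x rfl
    exact ht
  have key : ∀ t : Y, ∀ x (hx : f x = t),
      (G.induce (f ⁻¹' Y)).Reachable ⟨x, hfib t t.2 hx⟩ ⟨x₀, ht₀⟩ := by
    intro t
    refine reachable_invariant
      (P := fun t : Y => ∀ x (hx : f x = t),
        (G.induce (f ⁻¹' Y)).Reachable ⟨x, hfib t t.2 hx⟩ ⟨x₀, ht₀⟩)
      ?_ (hY.preconnected ⟨f x₀, ht₀⟩ t) ?_
    · intro a b hab ha x hx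
      have hab' : T.Adj a b := hab
      obtain ⟨u, v, hu, hv, huv⟩ := (hf.2.2 _ _ hab'.ne).1 hab'
      have h₁ := reachable_induce_mono (hfib b b.2) (hf.2.1 b) (x := x) (y := v) hx hv
      have h₂ : (G.induce (f ⁻¹' Y)).Adj ⟨v, hfib b b.2 hv⟩ ⟨u, hfib a a.2 hu⟩ := huv.symm
      exact h₁.trans (h₂.reachable.trans (ha u hu))
    · intro x hx
      exact reachable_induce_mono (hfib _ ht₀) (hf.2.1 (f x₀)) hx rfl
  rintro ⟨x, hx⟩
  exact key ⟨f x, hx⟩ x rfl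

/-- In an acyclic graph, distinct neighbours of a vertex are separated by it. -/
theorem eq_of_reachable_compl (hT : T.IsAcyclic) {u a b : W} (ha : T.Adj u a) (hb : T.Adj u b)
    (h : (T.induce ({u}ᶜ : Set W)).Reachable ⟨a, ha.ne'⟩ ⟨b, hb.ne'⟩) : a = b := by
  classical
  by_contra hab
  obtain ⟨p, hp⟩ := h.exists_isPath
  let i : T.induce ({u}ᶜ : Set W) →g T := (Embedding.induce _).toHom
  let q : T.Walk a b := p.map i
  have hq : q.IsPath := hp.map Subtype.val_injective
  have hu : u ∉ q.support := by
    intro hu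
    obtain ⟨x, -, hx⟩ := List.mem_map.1 ((Walk.support_map i p) ▸ hu)
    exact x.2 hx
  have hr : (Walk.cons ha.symm (Walk.cons hb Walk.nil)).IsPath := by
    simp [Walk.cons_isPath_iff, ha.ne', hb.ne, hab]
  have hqr : q = Walk.cons ha.symm (Walk.cons hb Walk.nil) :=
    congrArg Subtype.val ((hT.subsingleton_path a b).elim ⟨q, hq⟩ ⟨_, hr⟩)
  rw [hqr] at hu
  simp at hu

/-- Small witness sets of a 2-connected graph sit at vertices with at most one neighbour. -/
theorem neighbor_unique_of_not_bigSet [Finite V] (hG : TwoConnected G) (hT : T.IsAcyclic)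
    (hf : IsWitnessStructure G T f) {u a b : W} (hu : ¬ BigSet f u) (ha : T.Adj u a)
    (hb : T.Adj u b) : a = b := by
  obtain ⟨v, hv⟩ := hf.1 u
  obtain ⟨x, hx⟩ := hf.1 a
  obtain ⟨y, hy⟩ := hf.1 b
  have hmem : ∀ z : ({v}ᶜ : Set V), f z ∈ ({u}ᶜ : Set W) := fun z hz =>
    z.2 (eq_of_not_bigSet hu hz hv)
  have hxv : x ∈ ({v}ᶜ : Set V) := by
    rintro rfl
    exact ha.ne (hv.symm.trans hx)
  have hyv : y ∈ ({v}ᶜ : Set V) := by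
    rintro rfl
    exact hb.ne (hv.symm.trans hy)
  have hr := reachable_weakHom (T := T.induce ({u}ᶜ : Set W))
    (f := fun z : ({v}ᶜ : Set V) => (⟨f z, hmem z⟩ : ({u}ᶜ : Set W)))
    (fun z w hzw hne => hf.adj_of_adj (x := z) (y := w) hzw (fun he => hne (Subtype.ext he)))
    ((hG.2.2 v).preconnected ⟨x, hxv⟩ ⟨y, hyv⟩)
  subst hx hy
  exact eq_of_reachable_compl hT ha hb hr

/-- Of two adjacent witness sets of a 2-connected graph, at least one is big. -/
theorem bigSet_of_adj_of_not_bigSet [Finite V] (hG : TwoConnected G) (hT : T.IsTree)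
    (hf : IsWitnessStructure G T f) {u v : W} (huv : T.Adj u v) (hu : ¬ BigSet f u) :
    BigSet f v := by
  by_contra hv
  classical
  have hall : ∀ t, t = u ∨ t = v := fun t => by
    refine reachable_invariant (P := fun t => t = u ∨ t = v) ?_ (hT.connected.preconnected u t)
      (Or.inl rfl)
    rintro a b hab (rfl | rfl)
    · exact Or.inr (neighbor_unique_of_not_bigSet hG hT.isAcyclic hf hu hab huv)
    · exact Or.inl (neighbor_unique_of_not_bigSet hG hT.isAcyclic hf hv hab huv.symm)
  have hinj : Function.Injective fun x => decide (f x = u) := by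
    intro x y hxy
    have hxy : f x = u ↔ f y = u := by simpa using hxy
    rcases hall (f x) with h | h
    · exact eq_of_not_bigSet hu h (hxy.1 h)
    · refine eq_of_not_bigSet hv h ((hall (f y)).resolve_left fun h' => ?_)
      exact huv.ne ((hxy.2 h').symm.trans h)
  have := Nat.card_le_card_of_injective _ hinj
  have h3 := hG.2.1
  simp at this
  omega

/-- A tree with a compatible coloring retracts onto a subtree so that the monochromatic
components are the fibers of the composite with the witness map. -/
theorem exists_retraction [Finite V] (hG : TwoConnected G) (hT : T.IsTree)
    (hf : IsWitnessStructure G T f) (hφ : TreeCompatible G T f φ) :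
    ∃ r : W → W, (∀ t, r (r t) = r t) ∧ (∀ t, BigSet f t → r t = t) ∧
      (∀ t, r t ≠ t → T.Adj t (r t)) ∧
      (∀ u v, T.Adj u v → r u ≠ r v → T.Adj (r u) (r v)) ∧
      (∀ x y, r (f x) = r (f y) → φ x = φ y) ∧
      (∀ x y, G.Adj x y → φ x = φ y → r (f x) = r (f y)) := by
  classical
  obtain ⟨c, hc⟩ : ∃ c : W → Fin 2, ∀ x, φ x = c (f x) :=
    ⟨fun t => φ (Function.surjInv hf.1 t), fun x => hφ.1 _ _ (Function.surjInv_eq hf.1 _).symm⟩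
  let Q : W → W → Prop := fun t s => ¬ BigSet f t ∧ T.Adj t s ∧ c s = c t
  obtain ⟨r, hr₁, hr₂⟩ : ∃ r : W → W, (∀ t, r t = t ∨ Q t (r t)) ∧
      ∀ t s, Q t s → r t = s := by
    refine ⟨fun t => if h : ∃ s, Q t s then h.choose else t, fun t => ?_, fun t s hs => ?_⟩
    · by_cases h : ∃ s, Q t s
      · right
        simpa only [dif_pos h] using h.choose_spec
      · left
        simp only [dif_neg h]
    · have h : ∃ s, Q t s := ⟨s, hs⟩
      simp only [dif_pos h]
      exact neighbor_unique_of_not_bigSet hG hT.isAcyclic hf hs.1 h.choose_spec.2.1 hs.2.1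
  have hbig : ∀ t, BigSet f t → r t = t := fun t ht =>
    (hr₁ t).resolve_right fun h => h.1 ht
  have hmove : ∀ t, r t ≠ t → Q t (r t) := fun t ht => (hr₁ t).resolve_left ht
  have hcol : ∀ t, c (r t) = c t := fun t => by
    rcases hr₁ t with h | h
    · rw [h]
    · exact h.2.2
  have hcollapse : ∀ u v, T.Adj u v → r u ≠ u → r u = r v := by
    intro u v huv hu
    have h := hmove u hu
    rw [neighbor_unique_of_not_bigSet hG hT.isAcyclic hf h.1 h.2.1 huv,
      hbig v (bigSet_of_adj_of_not_bigSet hG hT hf huv h.1)]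
  refine ⟨r, fun t => ?_, hbig, fun t ht => (hmove t ht).2.1, fun u v huv hne => ?_,
    fun x y h => ?_, fun x y hxy h => ?_⟩
  · by_cases ht : r t = t
    · rw [ht, ht]
    · have h := hmove t ht
      exact hbig _ (bigSet_of_adj_of_not_bigSet hG hT hf h.2.1 h.1)
  · have hu : r u = u := by_contra fun hu => hne (hcollapse u v huv hu)
    have hv : r v = v := by_contra fun hv => hne (hcollapse v u huv.symm hv).symm
    rwa [hu, hv]
  · rw [hc, hc, ← hcol, h, hcol]
  · by_cases he : f x = f y
    · rw [he]
    have hadj := hf.adj_of_adj hxy he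
    have hcxy : c (f x) = c (f y) := by rw [← hc, ← hc, h]
    by_cases hx : BigSet f (f x)
    · have hy : ¬ BigSet f (f y) := fun hy => hφ.2 _ _ hadj hx hy x y rfl rfl h
      rw [hbig _ hx, hr₂ (f y) (f x) ⟨hy, hadj.symm, hcxy⟩]
    · rw [hr₂ (f x) (f y) ⟨hx, hadj, hcxy.symm⟩,
        hbig _ (bigSet_of_adj_of_not_bigSet hG hT hf hadj hx)]

/-- If the fibers of `k` are connected and monochromatic, and `k` is constant along
monochromatic edges, then the monochromatic components are the fibers of `k`. -/
theorem monoComponent_iff_fiber {U : Type} {k : V → U}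
    (hconn : ∀ x, (G.induce (k ⁻¹' {k x})).Connected) (hmono : ∀ x y, k x = k y → φ x = φ y)
    (hedge : ∀ x y, G.Adj x y → φ x = φ y → k x = k y) (X : Set V) :
    MonoComponent G φ X ↔ ∃ x, X = k ⁻¹' {k x} := by
  have hsub : ∀ Y : Set V, Monochromatic φ Y → (G.induce Y).Connected → ∀ x ∈ Y,
      Y ⊆ k ⁻¹' {k x} := by
    intro Y hY hYc x hx y hy
    exact reachable_invariant (P := fun z : Y => k z = k x)
      (fun a b hab ha => (hedge a b hab (hY a a.2 b b.2)).symm.trans ha)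
      (hYc.preconnected ⟨x, hx⟩ ⟨y, hy⟩) rfl
  have hfib : ∀ x, Monochromatic φ (k ⁻¹' {k x}) := fun x a ha b hb =>
    hmono a b (Eq.trans ha (Eq.symm hb))
  constructor
  · rintro ⟨⟨x, hx⟩, hm, hXc, hmax⟩
    exact ⟨x, (hmax _ (hsub X hm hXc x hx) (hfib x) (hconn x)).symm⟩
  · rintro ⟨x, rfl⟩
    exact ⟨⟨x, rfl⟩, hfib x, hconn x, fun Y hY hm hc =>
      (hsub Y hm hc x (hY rfl)).antisymm hY⟩

end Helpers

theorem stmt10 {V W : Type} [Finite V] [Finite W] (G : SimpleGraph V) (T : SimpleGraph W)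
    (hG : TwoConnected G) (hT : T.IsTree) (f : V → W) (hf : IsWitnessStructure G T f)
    (φ : V → Fin 2) (hφ : TreeCompatible G T f φ) :
    (∀ X : Set V, MonoComponent G φ X →
      (∃ Y : Set W, Y.Nonempty ∧ (T.induce Y).Connected ∧ X = f ⁻¹' Y) ∧
      (∀ u v : W, BigSet f u → BigSet f v → f ⁻¹' {u} ⊆ X → f ⁻¹' {v} ⊆ X → u = v)) ∧
    ∃ (n : ℕ) (T'' : SimpleGraph (Fin n)) (g : V → Fin n),
      n ≤ Nat.card W ∧ T''.IsTree ∧ IsWitnessStructure G T'' g ∧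
      ∀ X : Set V, MonoComponent G φ X ↔ ∃ j : Fin n, X = g ⁻¹' {j} := by
  obtain ⟨r, hidem, hbig, hmove, hadj, hmono, hedge⟩ := exists_retraction hG hT hf hφ
  have hstar : ∀ t, (T.induce (r ⁻¹' {r t})).Connected := by
    intro t
    refine connected_of_common_reachable (v := ⟨r t, hidem t⟩) ?_
    rintro ⟨s, hs⟩
    have hs : r s = r t := hs
    by_cases he : r s = s
    · have : s = r t := he.symm.trans hs
      subst this
      exact Reachable.refl _
    · have h : T.Adj s (r t) := hs ▸ hmove s he
      exact Adj.reachable h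
  have hconn : ∀ t, (G.induce (f ⁻¹' (r ⁻¹' {r t}))).Connected := fun t =>
    hf.connected_preimage (hstar t)
  have hcomp := monoComponent_iff_fiber (G := G) (k := fun x => r (f x))
    (fun x => hconn (f x)) hmono hedge
  refine ⟨fun X hX => ?_, ?_⟩
  · obtain ⟨x, rfl⟩ := (hcomp X).1 hX
    refine ⟨⟨r ⁻¹' {r (f x)}, ⟨f x, rfl⟩, hstar _, rfl⟩, ?_⟩
    have hroot : ∀ u, BigSet f u → f ⁻¹' {u} ⊆ (fun x => r (f x)) ⁻¹' {r (f x)} →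
        u = r (f x) := by
      intro u hu hsub
      obtain ⟨y, rfl⟩ := hf.1 u
      exact (hbig _ hu).symm.trans (hsub rfl)
    intro u v hu hv hsu hsv
    exact (hroot u hu hsu).trans (hroot v hv hsv).symm
  · let R : Set W := Set.range r
    let ρ : W → R := fun t => ⟨r t, t, rfl⟩
    have hρ : Function.Surjective ρ := fun ⟨s, t, ht⟩ => ⟨t, Subtype.ext ht⟩
    have hfix : ∀ s : R, ρ s = s := fun ⟨s, t, ht⟩ => Subtype.ext (by
      subst ht
      exact hidem t)
    let e : R ≃ Fin (Nat.card R) := Finite.equivFin R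
    let T' : SimpleGraph (Fin (Nat.card R)) := (T.induce R).comap e.symm
    let i : T' ≃g T.induce R := Iso.comap e.symm _
    have hRc : (T.induce R).Connected := by
      obtain ⟨t₀⟩ := hT.connected.nonempty
      refine connected_of_common_reachable (v := ρ t₀) fun s => ?_
      have := reachable_weakHom (T := T.induce R) (f := ρ)
        (fun a b hab hne => hadj a b hab fun h => hne (Subtype.ext h))
        (hT.connected.preconnected s t₀)
      rwa [hfix] at this
    let g : V → Fin (Nat.card R) := fun x => e (ρ (f x))
    have hsurj : Function.Surjective g :=
      e.surjective.comp (hρ.comp hf.1)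
    have hfiber : ∀ x, g ⁻¹' {g x} = f ⁻¹' (r ⁻¹' {r (f x)}) := fun x =>
      Set.ext fun y => e.injective.eq_iff.trans Subtype.ext_iff
    refine ⟨Nat.card R, T', g, Nat.card_le_card_of_injective _
      Subtype.val_injective, ⟨i.connected_iff.2 hRc, ?_⟩, ⟨hsurj, fun j => ?_, fun j₁ j₂ hne => ?_⟩,
      fun X => ?_⟩
    · exact (hT.isAcyclic.induce R).comap i.toHom i.injective
    · obtain ⟨x, rfl⟩ := hsurj j
      rw [hfiber]
      exact hconn _
    · constructor
      · intro h
        have h : T.Adj (e.symm j₁ : R) (e.symm j₂ : R) := h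
        obtain ⟨u, v, hu, hv, huv⟩ := (hf.2.2 _ _ h.ne).1 h
        refine ⟨u, v, ?_, ?_, huv⟩
        · simp only [g, hu, hfix, e.apply_symm_apply]
        · simp only [g, hv, hfix, e.apply_symm_apply]
      · rintro ⟨u, v, rfl, rfl, huv⟩
        have hr : r (f u) ≠ r (f v) := fun h => hne (congrArg e (Subtype.ext h))
        have : T.Adj (r (f u)) (r (f v)) :=
          hadj _ _ (hf.adj_of_adj huv fun h => hr (congrArg r h)) hr
        change T.Adj (e.symm (e (ρ (f u))) : R) (e.symm (e (ρ (f v))) : R)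
        rwa [e.symm_apply_apply, e.symm_apply_apply]
    · rw [hcomp, hsurj.exists]
      simp only [hfiber]
      rfl
end

section
/- Let G be a graph on n vertices, let T be a tree, and let W be a T-witness structure of G with n − |V(T)| ≤ k. Then there exists a 2-coloring ψ of G compatible with W such that every 2-coloring of G that coincides with ψ on all vertices belonging to big witness sets of W is also compatible with W; consequently, the number of 2-colorings of G compatible with W is at least 2^{n−2k}. -/
open SimpleGraph

/-- A vertex outside the image of a section of `f` accounts for itself and for one vertex in the
image, so big witness sets cover at most twice as many vertices as the contraction removes. -/
lemma ncard_setOf_bigSet_le {V W : Type} [Finite V] {f : V → W} (hf : Function.Surjective f) :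
    {x | BigSet f (f x)}.ncard ≤ 2 * (Nat.card V - Nat.card W) := by
  obtain ⟨g, hg⟩ := hf.hasRightInverse
  have hcard := Set.ncard_add_ncard_compl (Set.range g)
  rw [Set.ncard_range_of_injective hg.injective] at hcard
  have hsub : {x | BigSet f (f x)} ⊆ (Set.range g)ᶜ ∪ (g ∘ f) '' (Set.range g)ᶜ := by
    intro x hx
    by_cases hxg : x ∈ Set.range g
    · obtain ⟨h, rfl⟩ := hxg
      obtain ⟨y, hy, hne⟩ := Set.exists_ne_of_one_lt_ncard hx (g h)
      have hyh : f y = h := Eq.trans hy (hg h)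
      refine Or.inr ⟨y, ?_, congrArg g hyh⟩
      rintro ⟨h', rfl⟩
      exact hne (congrArg g ((hg h').symm.trans hyh))
    · exact Or.inl hxg
  have h₁ := Set.ncard_le_ncard hsub
  have h₂ := Set.ncard_union_le (Set.range g)ᶜ ((g ∘ f) '' (Set.range g)ᶜ)
  have h₃ := Set.ncard_image_le (f := g ∘ f) (s := (Set.range g)ᶜ)
  omega

/-- Compatibility only depends on the colors of the vertices in big witness sets. -/
lemma TreeCompatible.of_eq_on_bigSet {V W : Type} [Finite V] {G : SimpleGraph V}
    {T : SimpleGraph W} {f : V → W} {φ ψ : V → Fin 2} (hψ : TreeCompatible G T f ψ)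
    (h : ∀ x, BigSet f (f x) → φ x = ψ x) : TreeCompatible G T f φ := by
  refine ⟨fun x y hxy => ?_, fun u v huv hu hv x y hx hy => ?_⟩
  · rcases eq_or_ne x y with rfl | hne
    · rfl
    · have hbig : BigSet f (f x) := (Set.one_lt_ncard (Set.toFinite _)).2
        ⟨x, rfl, y, hxy.symm, hne⟩
      rw [h x hbig, h y (hxy ▸ hbig), hψ.1 x y hxy]
  · rw [h x (hx ▸ hu), h y (hy ▸ hv)]
    exact hψ.2 u v huv hu hv x y hx hy

/-- A coloring can be altered freely outside `s`. -/
lemma two_pow_le_ncard_setOf_eqOn {V : Type} [Finite V] (s : Set V) (ψ : V → Fin 2) :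
    2 ^ (Nat.card V - s.ncard) ≤ {φ : V → Fin 2 | Set.EqOn φ ψ s}.ncard := by
  classical
  have hcompl : Nat.card V - s.ncard = Nat.card ↥sᶜ := by
    have := Set.ncard_add_ncard_compl s
    rw [Nat.card_coe_set_eq]
    omega
  let extend : (↥sᶜ → Fin 2) → {φ : V → Fin 2 | Set.EqOn φ ψ s} := fun c =>
    ⟨fun x => if hx : x ∈ s then ψ x else c ⟨x, hx⟩, fun x hx => by simp [hx]⟩
  have hinj : Function.Injective extend := by
    intro c d hcd
    funext x
    have hx := congrFun (congrArg Subtype.val hcd) x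
    simpa [extend, show (x : V) ∉ s from x.2] using hx
  have hle := Nat.card_le_card_of_injective extend hinj
  rwa [Nat.card_fun, Nat.card_fin, Nat.card_coe_set_eq {φ : V → Fin 2 | _}, ← hcompl] at hle

theorem stmt12 {V W : Type} [Finite V] [Finite W] (G : SimpleGraph V) (T : SimpleGraph W)
    (hT : T.IsTree) (f : V → W) (hf : IsWitnessStructure G T f) (k : ℕ)
    (hk : Nat.card V - Nat.card W ≤ k) :
    ∃ ψ : V → Fin 2, TreeCompatible G T f ψ ∧
      (∀ φ : V → Fin 2, (∀ x : V, BigSet f (f x) → φ x = ψ x) →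
        TreeCompatible G T f φ) ∧
      2 ^ (Nat.card V - 2 * k) ≤ {φ : V → Fin 2 | TreeCompatible G T f φ}.ncard := by
  obtain ⟨c⟩ := hT.colorable_two
  have hψ : TreeCompatible G T f (c ∘ f) := by
    refine ⟨fun x y hxy => congrArg c hxy, ?_⟩
    rintro u v huv - - x y rfl rfl
    exact c.valid huv
  refine ⟨c ∘ f, hψ, fun φ h => hψ.of_eq_on_bigSet h, ?_⟩
  have hbig := ncard_setOf_bigSet_le hf.1
  calc 2 ^ (Nat.card V - 2 * k)
      ≤ 2 ^ (Nat.card V - {x | BigSet f (f x)}.ncard) :=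
        Nat.pow_le_pow_right two_pos (by omega)
    _ ≤ _ := two_pow_le_ncard_setOf_eqOn _ (c ∘ f)
    _ ≤ _ := Set.ncard_le_ncard fun φ h => hψ.of_eq_on_bigSet fun x hx => h hx
end
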